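/- Let n ≥ 1 and let Y and Y' be Young diagrams contained in δ_{n−1}, regarded as elements of the Tamari lattice T_n via the correspondence with Dyck paths. Then Y' covers Y in T_n if and only if there exists a corner box B in Y such that Y' is obtained from Y by removing the B-strip. -/

import Mathlib

/-!
Common definitions for formalizing "A recursion on maximal chains in the Tamari lattices"
(L. Nelson).

* Young diagrams are encoded by their row-length functions `lam : ℕ → ℕ` (rows indexed from 1,
  with `lam 0 = 0`).
* Dyck paths are lists of steps (north/east).
* Tableaux are encoded by entry functions `f : ℕ × ℕ → ℕ` (1-indexed boxes; value `0` means
  "no box").  The label of box `(x, y)` is `f (x, y)`.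
-/

noncomputable section

namespace TamariMaxChains

/-- A step of a lattice path: north or east. -/
inductive Step : Type
  | N : Step
  | E : Step
deriving DecidableEq

/-- Number of north steps of a path. -/
def nCount (p : List Step) : ℕ := p.count Step.N

/-- Number of east steps of a path. -/
def eCount (p : List Step) : ℕ := p.count Step.E

/-- `p` is a Dyck path: equally many norths and easts, and every prefix has at least as many
north steps as east steps (the path never goes below the diagonal `y = x`). -/
def IsDyck (p : List Step) : Prop :=
  nCount p = eCount p ∧ ∀ q : List Step, q <+: p → eCount q ≤ nCount q

/-- `q` is a prime Dyck path: it meets the slope-one line joining its endpoints only at its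
endpoints. -/
def IsPrimeDyck (q : List Step) : Prop :=
  q ≠ [] ∧ nCount q = eCount q ∧
    ∀ s : List Step, s <+: q → s ≠ [] → s ≠ q → eCount s < nCount s

/-- Covering relation of the Tamari lattice on Dyck paths:  `TamariCoverD P' P` means `P'`
covers `P`, i.e. `P'` is obtained from `P` by swapping an east step that is followed by a north
step with the prime Dyck subpath following it. -/
def TamariCoverD (P' P : List Step) : Prop :=
  ∃ a q b : List Step, IsPrimeDyck q ∧
    P = a ++ Step.E :: (q ++ b) ∧ P' = a ++ (q ++ Step.E :: b)

/-- `lam` is the row-length function of a Young diagram: rows are indexed from `1`,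
`lam x` is the number of boxes in row `x`, rows weakly decrease, finitely many boxes. -/
def IsDiagram (lam : ℕ → ℕ) : Prop :=
  lam 0 = 0 ∧ (∀ x, 1 ≤ x → lam (x + 1) ≤ lam x) ∧ ∃ N, ∀ x, N ≤ x → lam x = 0

/-- The height (number of north steps) of the prime path of row `d ≥ 1` of the Young diagram
with row lengths `lam`:  the least `t ≥ 1` such that either `t = d` (row `0` being regarded as
an infinite row of boxes) or row `d - t` has length at least `lam d + t`. -/
def primeHeight (lam : ℕ → ℕ) (d : ℕ) : ℕ :=
  sInf {t | 1 ≤ t ∧ (t = d ∨ (t < d ∧ lam d + t ≤ lam (d - t)))}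

/-- The last box of row `d` is a corner box (last box of its row and lowest box of
its column). -/
def IsCorner (lam : ℕ → ℕ) (d : ℕ) : Prop := 1 ≤ d ∧ 1 ≤ lam d ∧ lam (d + 1) < lam d

/-- The result of removing the `B`-strip of the last box `B` of row `d`: the last box of each of
the rows `d - h + 1, …, d` is removed, where `h` is the height of the prime path of row `d`. -/
def removeStrip (lam : ℕ → ℕ) (d : ℕ) : ℕ → ℕ := fun x =>
  if d + 1 ≤ x + primeHeight lam d ∧ x ≤ d then lam x - 1 else lam x

/-- Covering relation of the Tamari lattice on Young diagrams:  `mu` covers `lam` iff `mu` is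
obtained from `lam` by removing the `B`-strip of a corner box `B`. -/
def TamariCoverY (mu lam : ℕ → ℕ) : Prop := ∃ d, IsCorner lam d ∧ mu = removeStrip lam d

/-- The `B`-strip of the last box `B` of row `d`: the set of last boxes of rows
`d - h + 1, …, d`, where `h` is the height of the prime path of row `d`. -/
def stripSet (lam : ℕ → ℕ) (d : ℕ) : Set (ℕ × ℕ) :=
  {b | b.2 = lam b.1 ∧ 1 ≤ b.2 ∧ d + 1 ≤ b.1 + primeHeight lam d ∧ b.1 ≤ d}

/-- The enclosure of the `B`-strip of the last box `B = (d, lam d)` of row `d`: all boxes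
`(x, y)` with `d - h ≤ x ≤ d` and `lam d ≤ y ≤ lam d + h`, where row `0` is regarded as an
infinite row of boxes. -/
def enclosure (lam : ℕ → ℕ) (d : ℕ) : Set (ℕ × ℕ) :=
  {b | (b.1 = 0 ∨ b.2 ≤ lam b.1) ∧ 1 ≤ b.2 ∧
    d ≤ b.1 + primeHeight lam d ∧ b.1 ≤ d ∧ lam d ≤ b.2 ∧ b.2 ≤ lam d + primeHeight lam d}

/-- The Dyck path of length `2 n` corresponding to the Young diagram `lam` contained in the
staircase `δ_{n-1}` (the Dyck path is the silhouette of the Young diagram). -/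
def toDyck (n : ℕ) (lam : ℕ → ℕ) : List Step :=
  ((List.range n).flatMap fun k =>
    List.replicate (lam (n - k) - lam (n - k + 1)) Step.E ++ [Step.N]) ++
    List.replicate (n - lam 1) Step.E

/-- The prime path of row `d` of the Young diagram `lam`, as its list of steps (read from its
lower-left endpoint). -/
def primePathList (lam : ℕ → ℕ) (d : ℕ) : List Step :=
  Step.N :: ((((List.range (primeHeight lam d - 1)).flatMap fun j =>
    List.replicate (lam (d - 1 - j) - lam (d - j)) Step.E ++ [Step.N])) ++
    List.replicate (lam d + primeHeight lam d - lam (d - (primeHeight lam d - 1))) Step.E)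

/-- `S` translates to `S'` by `p` units down and `q` units to the right. -/
def TranslatesBy (p q : ℤ) (S S' : Set (ℕ × ℕ)) : Prop :=
  ∀ x y : ℕ, (x, y) ∈ S' ↔ ∃ a b : ℕ, (a, b) ∈ S ∧ (x : ℤ) = a + p ∧ (y : ℤ) = b + q

/-- `S` translates to `S'`. -/
def Translates (S S' : Set (ℕ × ℕ)) : Prop := ∃ p q : ℤ, TranslatesBy p q S S'

/-- The length of a tableau: its number of distinct labels (for an honest tableau, labels are
exactly `1, …, tlen f`). -/
def tlen (f : ℕ × ℕ → ℕ) : ℕ := sSup {v | v ≠ 0 ∧ ∃ b, f b = v}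

/-- The number of boxes in row `x` of a tableau. -/
def rowLen (f : ℕ × ℕ → ℕ) (x : ℕ) : ℕ := sSup {y | f (x, y) ≠ 0}

/-- The number of boxes in column `y` of a tableau. -/
def colLen (f : ℕ × ℕ → ℕ) (y : ℕ) : ℕ := sSup {x | f (x, y) ≠ 0}

/-- `f` is (the entry function of) a tableau: the support is a Young diagram (1-indexed),
rows strictly increase, columns weakly increase, and the set of labels is exactly
`{1, …, tlen f}`. -/
def IsTableau (f : ℕ × ℕ → ℕ) : Prop :=
  (∀ y, f (0, y) = 0) ∧ (∀ x, f (x, 0) = 0) ∧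
  {b : ℕ × ℕ | f b ≠ 0}.Finite ∧
  (∀ x y x' y', 1 ≤ x' → x' ≤ x → 1 ≤ y' → y' ≤ y → f (x, y) ≠ 0 → f (x', y') ≠ 0) ∧
  (∀ x y, f (x, y) ≠ 0 → f (x, y + 1) ≠ 0 → f (x, y) < f (x, y + 1)) ∧
  (∀ x y, f (x, y) ≠ 0 → f (x + 1, y) ≠ 0 → f (x, y) ≤ f (x + 1, y)) ∧
  (∀ v, 1 ≤ v → (v ≤ tlen f ↔ ∃ b, f b = v))

/-- `T^(r)`: the subtableau of all entries at most `r`. -/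
def trunc (f : ℕ × ℕ → ℕ) (r : ℕ) : ℕ × ℕ → ℕ := fun b => if f b ≤ r then f b else 0

/-- The shape (row-length function) of a tableau. -/
def shapeOf (f : ℕ × ℕ → ℕ) : ℕ → ℕ := fun x => rowLen f x

/-- The row index of the end-box of the `k`-set of `f` (the maximal row index of a box
labeled `k`). -/
def endRow (f : ℕ × ℕ → ℕ) (k : ℕ) : ℕ := sSup {x | ∃ y, f (x, y) = k}

/-- `Y 0 ⋗ Y 1 ⋗ ⋯ ⋗ Y l` is a saturated chain in the Tamari order on Young diagrams whose
maximal element `Y 0` is the empty diagram (each `Y r` covers `Y (r+1)`). -/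
def IsTamariChain (Y : ℕ → ℕ → ℕ) (l : ℕ) : Prop :=
  (∀ r, r ≤ l → IsDiagram (Y r)) ∧ (∀ x, Y 0 x = 0) ∧
    ∀ r, r < l → TamariCoverY (Y r) (Y (r + 1))

/-- The tableau `ψ(C)` of the saturated chain `C = (∅ = Y 0 ⋗ ⋯ ⋗ Y l)`: the boxes removed in
the transition `Y (r-1) ⋗ Y r` are labeled `r`; that is, each box of `Y l` is labeled by the
least `r` such that the box belongs to `Y r`. -/
def psiFun (Y : ℕ → ℕ → ℕ) (l : ℕ) : ℕ × ℕ → ℕ := fun b =>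
  if 1 ≤ b.1 ∧ 1 ≤ b.2 ∧ b.2 ≤ Y l b.1 then sInf {r | r ≤ l ∧ b.2 ≤ Y r b.1} else 0

/-- `f` is a `ψ`-tableau: it is in the image of `ψ`. -/
def IsPsiTab (f : ℕ × ℕ → ℕ) : Prop :=
  ∃ l Y, IsTamariChain Y l ∧ f = psiFun Y l

/-- Row lengths of the staircase shape `δ_{n-1} = (n-1, n-2, …, 1)`: row `x ≥ 1` has `n - x`
boxes. -/
def dstair (n : ℕ) : ℕ → ℕ := fun x => if x = 0 then 0 else n - x

/-- `C_i(n)`, via `ψ`: the set of maximal chains of length `n + i` in the Tamari lattice `T_n`,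
identified with the `ψ`-tableaux of length `n + i` and shape `δ_{n-1}`. -/
def MemC (i : ℤ) (n : ℕ) (f : ℕ × ℕ → ℕ) : Prop :=
  IsTableau f ∧ IsPsiTab f ∧ (∀ x, rowLen f x = dstair n x) ∧ (tlen f : ℤ) = (n : ℤ) + i

/-- The `r`-set of `f` (of shape `δ_{n-1}`) is a full-set with end-box `(k, n - k)`:
it begins in row `1` and ends in the outer diagonal, at the box `(k, n - k)`. -/
def HasFullSetAt (f : ℕ × ℕ → ℕ) (n r k : ℕ) : Prop :=
  (∃ y, f (1, y) = r) ∧ 1 ≤ k ∧ k ≤ n - 1 ∧ f (k, n - k) = r ∧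
    ∀ x y, f (x, y) = r → x ≤ k

/-- `f` has an `r`-full-set. -/
def HasFullSet (f : ℕ × ℕ → ℕ) (n r : ℕ) : Prop := ∃ k, HasFullSetAt f n r k

/-- `f` has an `r⁺`-full-set (plus-full-set): an `r`-full-set whose end-box `(k, n-k)` satisfies
`k = n - 1`, or `k ≤ n - 2` and the southwest neighbor has a smaller label. -/
def HasPlusFullSet (f : ℕ × ℕ → ℕ) (n r : ℕ) : Prop :=
  ∃ k, HasFullSetAt f n r k ∧ (k = n - 1 ∨ (k ≤ n - 2 ∧ f (k + 1, n - k - 1) < r))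

/-- `F_i^r(n)`: the set of `C ∈ C_i(n)` whose `r`-set is a plus-full-set and whose `j`-set is
not a plus-full-set for any `j ∈ [r-1]`. -/
def MemF (i : ℤ) (n : ℕ) (r : ℕ) (f : ℕ × ℕ → ℕ) : Prop :=
  MemC i n f ∧ HasPlusFullSet f n r ∧ ∀ j, 1 ≤ j → j < r → ¬ HasPlusFullSet f n j

/-- `N_i(n)`: the set of `C ∈ C_i(n)` having no plus-full-sets. -/
def MemN (i : ℤ) (n : ℕ) (f : ℕ × ℕ → ℕ) : Prop :=
  MemC i n f ∧ ∀ r, ¬ HasPlusFullSet f n r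

/-- `α_d`: shift all rows of index greater than `d` down one row and repeat row `d` in
row `d + 1`. -/
def alphaFun (d : ℕ) (f : ℕ × ℕ → ℕ) : ℕ × ℕ → ℕ := fun b =>
  if b.1 ≤ d then f b else f (b.1 - 1, b.2)

/-- `β_d`: append a box labeled `tlen f + 1` at the end of each of the rows `1, …, d`. -/
def betaFun (d : ℕ) (f : ℕ × ℕ → ℕ) : ℕ × ℕ → ℕ := fun b =>
  if 1 ≤ b.1 ∧ b.1 ≤ d ∧ b.2 = rowLen f b.1 + 1 then tlen f + 1 else f b

/-- The number of boxes of row `x` of `f` whose label is at most `r` (these occupy an initial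
segment of the row). -/
def lowLen (f : ℕ × ℕ → ℕ) (r x : ℕ) : ℕ := sSup {y | f (x, y) ≠ 0 ∧ f (x, y) ≤ r}

/-- The row index `d` used in the definition of `Ĉ(r)`: the minimal `k ∈ [n-1]` with
`C (k, n-k) ≤ r` if such `k` exists, and `n` otherwise. -/
def hatD (f : ℕ × ℕ → ℕ) (n r : ℕ) : ℕ :=
  sInf ({k | 1 ≤ k ∧ k ≤ n - 1 ∧ 1 ≤ f (k, n - k) ∧ f (k, n - k) ≤ r} ∪ {n})

/-- `Ĉ(r)` for `C ∈ C_i(n)` and `0 ≤ r ≤ n + i`: starting from `β_d(α_d(C^(r)))` (where `d` is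
as in `hatD`), the entries of `C` greater than `r` of row index less than `d` are translated one
unit to the right, those of row index greater than `d` are translated one unit down, and all
these labels are incremented by one. -/
def hatFun (f : ℕ × ℕ → ℕ) (n r : ℕ) : ℕ × ℕ → ℕ := fun b =>
  let d := hatD f n r
  let x := b.1
  let y := b.2
  if x = 0 ∨ y = 0 then 0
  else if x ≤ d then
    if f (x, y) ≠ 0 ∧ f (x, y) ≤ r then f (x, y)
    else if y = lowLen f r x + 1 then r + 1
    else if r < f (x, y - 1) then f (x, y - 1) + 1
    else 0
  else if x = d + 1 then f (d, y)
  else if f (x - 1, y) = 0 then 0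
  else if f (x - 1, y) ≤ r then f (x - 1, y)
  else f (x - 1, y) + 1

/-- `RepBy i m t r C0 C` : `C = (φ_{i,m+t-1}^{r 1} ∘ φ_{i,m+t-2}^{r 2} ∘ ⋯ ∘ φ_{i,m}^{r t}) C0`,
each factor being applied within its domain. -/
def RepBy (i : ℤ) (m t : ℕ) (r : ℕ → ℕ) (C0 C : ℕ × ℕ → ℕ) : Prop :=
  ∃ D : ℕ → ℕ × ℕ → ℕ, D 0 = C0 ∧ D t = C ∧
    ∀ s, s < t →
      MemC i (m + s) (D s) ∧
      ((r (t - s) : ℤ) ≤ (m : ℤ) + s + i) ∧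
      (∀ j, 1 ≤ j → j ≤ r (t - s) → ¬ HasPlusFullSet (D s) (m + s) j) ∧
      D (s + 1) = hatFun (D s) (m + s) (r (t - s))

/-- The set `𝕏_{d,n-1}^r` of Theorem 4.3: `ψ`-tableaux of length `r`, contained in `δ_{n-1}`,
whose row `d` has length `n - d` and whose prime path of row `d` has height `d`. -/
def MemX (d n r : ℕ) (f : ℕ × ℕ → ℕ) : Prop :=
  IsTableau f ∧ IsPsiTab f ∧ tlen f = r ∧
    (∀ x, 1 ≤ x → rowLen f x ≤ n - x) ∧
    rowLen f d = n - d ∧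
    primeHeight (shapeOf f) d = d

/-- The set `ℤ_{d,n}^{r+1}` of Theorem 4.3: `ψ`-tableaux of length `r + 1`, contained in `δ_n`,
such that rows `d` and `d+1` of the truncation at `r` are identical, the end-box of the
`(r+1)`-set is `(d, n-d+1)`, and the prime path of `(d, n-d+1)` has height `d`. -/
def MemZ (d n r : ℕ) (g : ℕ × ℕ → ℕ) : Prop :=
  IsTableau g ∧ IsPsiTab g ∧ tlen g = r + 1 ∧
    (∀ x, 1 ≤ x → rowLen g x ≤ n + 1 - x) ∧
    (∀ y, trunc g r (d, y) = trunc g r (d + 1, y)) ∧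
    g (d, n - d + 1) = r + 1 ∧ (∀ x y, g (x, y) = r + 1 → x ≤ d) ∧
    primeHeight (shapeOf g) d = d

/-! ### Auxiliary material for the proof -/

/-- The number of east steps before the `k`-th north step (counted from `0`); the total number
of east steps if there are at most `k` north steps. -/
def ec : List Step → ℕ → ℕ
  | [], _ => 0
  | Step.E :: p, k => ec p k + 1
  | Step.N :: _, 0 => 0
  | Step.N :: p, k + 1 => ec p k

theorem nCount_nil : nCount [] = 0 := rfl

theorem eCount_nil : eCount [] = 0 := rfl

theorem nCount_N (p : List Step) : nCount (Step.N :: p) = nCount p + 1 := by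
  simp [nCount]

theorem nCount_E (p : List Step) : nCount (Step.E :: p) = nCount p := by
  simp [nCount]

theorem eCount_N (p : List Step) : eCount (Step.N :: p) = eCount p := by
  simp [eCount]

theorem eCount_E (p : List Step) : eCount (Step.E :: p) = eCount p + 1 := by
  simp [eCount]

theorem nCount_append (p q : List Step) : nCount (p ++ q) = nCount p + nCount q := by
  simp [nCount]

theorem eCount_append (p q : List Step) : eCount (p ++ q) = eCount p + eCount q := by
  simp [eCount]

theorem nCount_replicate (j : ℕ) : nCount (List.replicate j Step.E) = 0 := by
  simp [nCount, List.count_replicate]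

theorem eCount_replicate (j : ℕ) : eCount (List.replicate j Step.E) = j := by
  simp [eCount]

theorem ec_of_ge (p : List Step) : ∀ k, nCount p ≤ k → ec p k = eCount p := by
  induction p with
  | nil => intro k _; rfl
  | cons s p ih =>
    intro k hk
    cases s with
    | E =>
      rw [nCount_E] at hk
      rw [ec, eCount_E, ih k hk]
    | N =>
      rw [nCount_N] at hk
      cases k with
      | zero => omega
      | succ k => rw [ec, eCount_N, ih k (by omega)]

theorem ec_append_lt (p q : List Step) : ∀ k, k < nCount p → ec (p ++ q) k = ec p k := by
  induction p with
  | nil => intro k hk; rw [nCount_nil] at hk; omega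
  | cons s p ih =>
    intro k hk
    cases s with
    | E =>
      rw [nCount_E] at hk
      rw [List.cons_append, ec, ec, ih k hk]
    | N =>
      rw [nCount_N] at hk
      cases k with
      | zero => rfl
      | succ k => rw [List.cons_append, ec, ec, ih k (by omega)]

theorem ec_append_ge (p q : List Step) :
    ∀ k, nCount p ≤ k → ec (p ++ q) k = eCount p + ec q (k - nCount p) := by
  induction p with
  | nil => intro k hk; simp [eCount_nil, nCount_nil]
  | cons s p ih =>
    intro k hk
    cases s with
    | E =>
      rw [nCount_E] at hk
      rw [List.cons_append, ec, ih k hk, eCount_E, nCount_E]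
      omega
    | N =>
      rw [nCount_N] at hk
      cases k with
      | zero => omega
      | succ k =>
        rw [List.cons_append, ec, ih k (by omega), eCount_N, nCount_N]
        congr 2
        omega

theorem ec_inj (p : List Step) : ∀ q, nCount p = nCount q → (∀ k, ec p k = ec q k) → p = q := by
  induction p with
  | nil =>
    intro q hn hk
    cases q with
    | nil => rfl
    | cons s q =>
      cases s with
      | E => have := hk 0; simp [ec] at this
      | N => rw [nCount_N, nCount_nil] at hn; omega
  | cons s p ih =>
    intro q hn hk
    cases q with
    | nil =>
      cases s with
      | E => have := hk 0; simp [ec] at this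
      | N => rw [nCount_N, nCount_nil] at hn; omega
    | cons t q =>
      cases s with
      | E =>
        cases t with
        | E =>
          rw [ih q (by simpa [nCount_E] using hn) (fun k => by have := hk k; simpa [ec] using this)]
        | N => have := hk 0; simp [ec] at this
      | N =>
        cases t with
        | E => have := hk 0; simp [ec] at this
        | N =>
          rw [ih q (by simpa [nCount_N] using hn)
            (fun k => by have := hk (k + 1); simpa [ec] using this)]

/-- The prefix before the `k`-th north step. -/
theorem exists_initial_part (p : List Step) :
    ∀ k, k < nCount p → ∃ s, s <+: p ∧ nCount s = k ∧ eCount s = ec p k := by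
  induction p with
  | nil => intro k hk; rw [nCount_nil] at hk; omega
  | cons t p ih =>
    intro k hk
    cases t with
    | E =>
      rw [nCount_E] at hk
      obtain ⟨s, h1, h2, h3⟩ := ih k hk
      refine ⟨Step.E :: s, by simpa using h1, by rw [nCount_E, h2], by rw [eCount_E, h3, ec]⟩
    | N =>
      rw [nCount_N] at hk
      cases k with
      | zero => exact ⟨[], by simp, rfl, rfl⟩
      | succ k =>
        obtain ⟨s, h1, h2, h3⟩ := ih k (by omega)
        refine ⟨Step.N :: s, by simpa using h1, by rw [nCount_N, h2], by rw [eCount_N, h3, ec]⟩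

theorem exists_corner_split (p : List Step) : ∀ i, i < nCount p → (i = 0 → 0 < ec p 0) →
    (∀ j, i = j + 1 → ec p j < ec p i) →
    ∃ a r, p = a ++ Step.E :: (Step.N :: r) ∧ nCount a = i := by
  induction p with
  | nil => intro i hi; rw [nCount_nil] at hi; omega
  | cons t p ih =>
    intro i hi h0 hs
    cases t with
    | E =>
      rw [nCount_E] at hi
      by_cases hc : i = 0 ∧ ec p 0 = 0
      · obtain ⟨rfl, hc⟩ := hc
        cases p with
        | nil => rw [nCount_nil] at hi; omega
        | cons u p =>
          cases u with
          | E => simp [ec] at hc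
          | N => exact ⟨[], p, rfl, rfl⟩
      · obtain ⟨a, r, rfl, ha⟩ := ih i hi (fun h => by omega)
          (fun j hj => by have := hs j hj; simpa [ec] using this)
        exact ⟨Step.E :: a, r, rfl, by rw [nCount_E, ha]⟩
    | N =>
      rw [nCount_N] at hi
      cases i with
      | zero => have := h0 rfl; simp [ec] at this
      | succ i =>
        obtain ⟨a, r, rfl, ha⟩ := ih i (by omega)
          (fun h => by subst h; have := hs 0 rfl; simpa [ec] using this)
          (fun j hj => by subst hj; have := hs (j + 1) rfl; simpa [ec] using this)
        exact ⟨Step.N :: a, r, rfl, by rw [nCount_N, ha]⟩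

theorem exists_first_return (p : List Step) : ∀ k, nCount p + k ≤ eCount p →
    ∃ q b, p = q ++ b ∧ nCount q + k = eCount q ∧
      ∀ s, s <+: q → s ≠ q → eCount s < nCount s + k := by
  induction p with
  | nil =>
    intro k hk
    rw [nCount_nil, eCount_nil] at hk
    refine ⟨[], [], rfl, by rw [nCount_nil, eCount_nil]; omega, ?_⟩
    intro s hs hs'
    exact absurd (List.prefix_nil.mp hs) hs'
  | cons t p ih =>
    intro k hk
    cases k with
    | zero =>
      refine ⟨[], t :: p, rfl, rfl, ?_⟩
      intro s hs hs'
      exact absurd (List.prefix_nil.mp hs) hs'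
    | succ k =>
      cases t with
      | E =>
        rw [nCount_E, eCount_E] at hk
        obtain ⟨q, b, rfl, h1, h2⟩ := ih k (by omega)
        refine ⟨Step.E :: q, b, rfl, by rw [nCount_E, eCount_E]; omega, ?_⟩
        intro s hs hs'
        rcases List.prefix_cons_iff.mp hs with rfl | ⟨s', rfl, hp⟩
        · rw [nCount_nil, eCount_nil]; omega
        · have := h2 s' hp (fun h => hs' (by rw [h]))
          rw [nCount_E, eCount_E]; omega
      | N =>
        rw [nCount_N, eCount_N] at hk
        obtain ⟨q, b, rfl, h1, h2⟩ := ih (k + 2) (by omega)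
        refine ⟨Step.N :: q, b, rfl, by rw [nCount_N, eCount_N]; omega, ?_⟩
        intro s hs hs'
        rcases List.prefix_cons_iff.mp hs with rfl | ⟨s', rfl, hp⟩
        · rw [nCount_nil, eCount_nil]; omega
        · have := h2 s' hp (fun h => hs' (by rw [h]))
          rw [nCount_N, eCount_N]; omega

theorem exists_prime (r : List Step) (h : nCount (Step.N :: r) ≤ eCount (Step.N :: r)) :
    ∃ q b, Step.N :: r = q ++ b ∧ IsPrimeDyck q := by
  rw [nCount_N, eCount_N] at h
  obtain ⟨q, b, rfl, h1, h2⟩ := exists_first_return r 1 h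
  refine ⟨Step.N :: q, b, rfl, by simp, by rw [nCount_N, eCount_N]; omega, ?_⟩
  intro s hs hne hs'
  rcases List.prefix_cons_iff.mp hs with rfl | ⟨s', rfl, hp⟩
  · exact absurd rfl hne
  · have := h2 s' hp (fun h => hs' (by rw [h]))
    rw [nCount_N, eCount_N]; omega

theorem prime_pos {q : List Step} (hq : IsPrimeDyck q) : 1 ≤ nCount q := by
  obtain ⟨h1, h2, h3⟩ := hq
  cases q with
  | nil => exact absurd rfl h1
  | cons t q =>
    cases t with
    | E => rw [eCount_E] at h2; omega
    | N => rw [nCount_N]; omega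

theorem prime_ec_zero {q : List Step} (hq : IsPrimeDyck q) : ec q 0 = 0 := by
  have hp := prime_pos hq
  obtain ⟨h1, h2, h3⟩ := hq
  obtain ⟨s, hs, hn, he⟩ := exists_initial_part q 0 (by omega)
  by_cases hs0 : s = []
  · subst hs0; rw [← he]; rfl
  · have := h3 s hs hs0 (fun h => by subst h; omega)
    omega

theorem prime_ec_lt {q : List Step} (hq : IsPrimeDyck q) (t : ℕ) (ht : 1 ≤ t)
    (ht' : t < nCount q) : ec q t < t := by
  obtain ⟨h1, h2, h3⟩ := hq
  obtain ⟨s, hs, hn, he⟩ := exists_initial_part q t ht'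
  have := h3 s hs (fun h => by subst h; rw [nCount_nil] at hn; omega)
    (fun h => by subst h; omega)
  omega

theorem ec_block (j : ℕ) : ec (List.replicate j Step.E ++ [Step.N]) 0 = j := by
  rw [ec_append_ge _ _ _ (by rw [nCount_replicate]), eCount_replicate, nCount_replicate]
  rfl

theorem toDyck_aux (n : ℕ) (lam : ℕ → ℕ) (hlam : IsDiagram lam)
    (hlam' : ∀ x, 1 ≤ x → lam x ≤ n - x) : ∀ m, m ≤ n →
    nCount ((List.range m).flatMap fun k =>
      List.replicate (lam (n - k) - lam (n - k + 1)) Step.E ++ [Step.N]) = m ∧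
    eCount ((List.range m).flatMap fun k =>
      List.replicate (lam (n - k) - lam (n - k + 1)) Step.E ++ [Step.N]) = lam (n - m + 1) ∧
    ∀ k, k < m → ec ((List.range m).flatMap fun k =>
      List.replicate (lam (n - k) - lam (n - k + 1)) Step.E ++ [Step.N]) k = lam (n - k) := by
  intro m
  induction m with
  | zero =>
    intro _
    have := hlam' (n + 1) (by omega)
    refine ⟨rfl, ?_, fun k hk => by omega⟩
    simp only [List.range_zero, List.flatMap_nil, eCount_nil, Nat.sub_zero]
    omega
  | succ m ih =>
    intro hm
    obtain ⟨h1, h2, h3⟩ := ih (by omega)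
    have hmono := hlam.2.1 (n - m) (by omega)
    have e : n - (m + 1) + 1 = n - m := by omega
    rw [List.range_succ, List.flatMap_append, List.flatMap_singleton]
    refine ⟨?_, ?_, ?_⟩
    · rw [nCount_append, h1, nCount_append, nCount_replicate, nCount_N, nCount_nil]
    · rw [eCount_append, h2, eCount_append, eCount_replicate, eCount_N, eCount_nil, e]
      omega
    · intro k hk
      by_cases hkm : k < m
      · rw [ec_append_lt _ _ _ (by omega), h3 k hkm]
      · have : k = m := by omega
        subst this
        rw [ec_append_ge _ _ _ (by omega), h1, h2, Nat.sub_self, ec_block]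
        omega

theorem toDyck_spec (n : ℕ) (hn : 1 ≤ n) (lam : ℕ → ℕ) (hlam : IsDiagram lam)
    (hlam' : ∀ x, 1 ≤ x → lam x ≤ n - x) :
    nCount (toDyck n lam) = n ∧ eCount (toDyck n lam) = n ∧
      ∀ k, k < n → ec (toDyck n lam) k = lam (n - k) := by
  obtain ⟨h1, h2, h3⟩ := toDyck_aux n lam hlam hlam' n le_rfl
  have := hlam' 1 le_rfl
  rw [Nat.sub_self, Nat.zero_add] at h2
  refine ⟨?_, ?_, ?_⟩
  · rw [toDyck, nCount_append, h1, nCount_replicate]; omega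
  · rw [toDyck, eCount_append, h2, eCount_replicate]; omega
  · intro k hk
    rw [toDyck, ec_append_lt _ _ _ (by omega), h3 k hk]

/-- The effect of a swap at an east step on the Young diagram. -/
theorem swap_spec (n : ℕ) (hn : 1 ≤ n) (lam : ℕ → ℕ) (hlam : IsDiagram lam)
    (hlam' : ∀ x, 1 ≤ x → lam x ≤ n - x) (a q b : List Step) (hq : IsPrimeDyck q)
    (hP : toDyck n lam = a ++ Step.E :: (q ++ b)) :
    nCount a < n ∧ lam (n - nCount a) = eCount a + 1 ∧
    nCount (a ++ (q ++ Step.E :: b)) = n ∧ eCount (a ++ (q ++ Step.E :: b)) = n ∧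
    ec (a ++ (q ++ Step.E :: b)) (nCount a) = eCount a ∧
    ∀ k, k < n → ec (a ++ (q ++ Step.E :: b)) k = removeStrip lam (n - nCount a) (n - k) := by
  obtain ⟨h1, h2, h3⟩ := toDyck_spec n hn lam hlam hlam'
  have hpos := prime_pos hq
  have hz := prime_ec_zero hq
  have hne := hq.2.1
  rw [hP, nCount_append, nCount_E, nCount_append] at h1
  rw [hP, eCount_append, eCount_E, eCount_append] at h2
  -- values for the original path
  have v1 : ∀ k, k < nCount a → lam (n - k) = ec a k := by
    intro k hk
    rw [← h3 k (by omega), hP, ec_append_lt _ _ _ hk]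
  have v2 : ∀ t, t < nCount q → lam (n - (nCount a + t)) = eCount a + 1 + ec q t := by
    intro t ht
    rw [← h3 _ (by omega), hP, ec_append_ge _ _ _ (by omega), Nat.add_sub_cancel_left, ec,
      ec_append_lt _ _ _ ht]
    omega
  have v3 : ∀ t, nCount a + nCount q + t < n →
      lam (n - (nCount a + nCount q + t)) = eCount a + 1 + nCount q + ec b t := by
    intro t ht
    rw [← h3 _ ht, hP, ec_append_ge _ _ _ (by omega), ec, ec_append_ge _ _ _ (by omega)]
    have : nCount a + nCount q + t - nCount a - nCount q = t := by omega
    rw [this]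
    omega
  -- values for the new path
  have w1 : ∀ k, k < nCount a → ec (a ++ (q ++ Step.E :: b)) k = ec a k := by
    intro k hk
    rw [ec_append_lt _ _ _ hk]
  have w2 : ∀ t, t < nCount q →
      ec (a ++ (q ++ Step.E :: b)) (nCount a + t) = eCount a + ec q t := by
    intro t ht
    rw [ec_append_ge _ _ _ (by omega), Nat.add_sub_cancel_left, ec_append_lt _ _ _ ht]
  have w3 : ∀ t, ec (a ++ (q ++ Step.E :: b)) (nCount a + nCount q + t) =
      eCount a + 1 + nCount q + ec b t := by
    intro t
    rw [ec_append_ge _ _ _ (by omega), ec_append_ge _ _ _ (by omega), ec]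
    have : nCount a + nCount q + t - nCount a - nCount q = t := by omega
    rw [this]
    omega
  have hd : lam (n - nCount a) = eCount a + 1 := by
    have := v2 0 (by omega)
    rwa [hz] at this
  have hh : primeHeight lam (n - nCount a) = nCount q := by
    have hmem : nCount q ∈ {t | 1 ≤ t ∧ (t = n - nCount a ∨
        (t < n - nCount a ∧ lam (n - nCount a) + t ≤ lam (n - nCount a - t)))} := by
      refine ⟨hpos, ?_⟩
      by_cases hc : nCount q = n - nCount a
      · exact Or.inl hc
      · right
        refine ⟨by omega, ?_⟩
        have := v3 0 (by omega)
        have e : n - nCount a - nCount q = n - (nCount a + nCount q + 0) := by omega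
        rw [e, this, hd]
        omega
    refine le_antisymm (Nat.sInf_le hmem) ?_
    refine le_csInf ⟨_, hmem⟩ ?_
    rintro t ⟨ht1, ht2⟩
    by_contra hlt
    push Not at hlt
    rcases ht2 with ht2 | ⟨_, ht3⟩
    · omega
    · have e : n - nCount a - t = n - (nCount a + t) := by omega
      have := prime_ec_lt hq t ht1 hlt
      rw [e, v2 t hlt, hd] at ht3
      omega
  refine ⟨by omega, hd, ?_, ?_, ?_, ?_⟩
  · rw [nCount_append, nCount_append, nCount_E]; omega
  · rw [eCount_append, eCount_append, eCount_E]; omega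
  · have := w2 0 (by omega)
    rwa [hz] at this
  · intro k hk
    unfold removeStrip
    rw [hh]
    by_cases c1 : k < nCount a
    · rw [if_neg (by omega), w1 k c1, v1 k c1]
    · by_cases c2 : k < nCount a + nCount q
      · obtain ⟨t, rfl⟩ : ∃ t, k = nCount a + t := ⟨k - nCount a, by omega⟩
        rw [if_pos (by omega), w2 t (by omega), v2 t (by omega)]
        omega
      · obtain ⟨t, rfl⟩ : ∃ t, k = nCount a + nCount q + t :=
          ⟨k - nCount a - nCount q, by omega⟩
        rw [if_neg (by omega), w3 t, v3 t hk]

/-- **Proposition 2.2.**  Let `Y` and `Y'` be Young diagrams contained in the staircase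
`δ_{n-1}`, regarded as elements of the Tamari lattice `T_n` via the correspondence with Dyck
paths of length `2n`.  Then `Y'` covers `Y` in `T_n` if and only if there is a corner box `B`
of `Y` such that `Y'` is obtained from `Y` by removing the `B`-strip. -/
theorem covering_via_young_diagrams (n : ℕ) (hn : 1 ≤ n) (lam mu : ℕ → ℕ)
    (hlam : IsDiagram lam) (hmu : IsDiagram mu)
    (hlam' : ∀ x, 1 ≤ x → lam x ≤ n - x) (hmu' : ∀ x, 1 ≤ x → mu x ≤ n - x) :
    TamariCoverD (toDyck n mu) (toDyck n lam) ↔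
      ∃ d, IsCorner lam d ∧ mu = removeStrip lam d := by
  obtain ⟨l1, l2, l3⟩ := toDyck_spec n hn lam hlam hlam'
  obtain ⟨m1, m2, m3⟩ := toDyck_spec n hn mu hmu hmu'
  constructor
  · rintro ⟨a, q, b, hq, hP, hP'⟩
    obtain ⟨s1, s2, s3, s4, s5, s6⟩ := swap_spec n hn lam hlam hlam' a q b hq hP
    have key : mu = removeStrip lam (n - nCount a) := by
      funext x
      by_cases hx0 : x = 0
      · subst hx0
        have e1 := hlam.1
        have e2 := hmu.1
        unfold removeStrip
        split_ifs <;> omega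
      · by_cases hxn : x ≤ n
        · have e := s6 (n - x) (by omega)
          rw [← hP', m3 (n - x) (by omega)] at e
          have e' : n - (n - x) = x := by omega
          rwa [e'] at e
        · have e1 := hlam' x (by omega)
          have e2 := hmu' x (by omega)
          unfold removeStrip
          split_ifs <;> omega
    refine ⟨n - nCount a, ⟨by omega, by omega, ?_⟩, key⟩
    have e1 : mu (n - nCount a) = eCount a := by
      rw [← m3 _ s1, hP', s5]
    have e2 : mu (n - nCount a + 1) = lam (n - nCount a + 1) := by
      rw [key]
      unfold removeStrip
      rw [if_neg (by omega)]
    have e3 := hmu.2.1 (n - nCount a) (by omega)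
    omega
  · rintro ⟨d, ⟨hd1, hd2, hd3⟩, hmud⟩
    have hdn := hlam' d hd1
    have hnd : n - (n - d) = d := by omega
    obtain ⟨a, r, hP, ha⟩ := exists_corner_split (toDyck n lam) (n - d) (by omega)
      (fun h => by rw [l3 0 (by omega)]; omega)
      (fun j hj => by
        rw [l3 j (by omega), l3 (n - d) (by omega), hnd]
        have : n - j = d + 1 := by omega
        rwa [this])
    have hA : eCount a + 1 = lam d := by
      have := l3 (n - d) (by omega)
      rw [hnd, hP, ec_append_ge _ _ _ (by omega), ha, Nat.sub_self, ec, ec] at this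
      omega
    have hcount : nCount (Step.N :: r) ≤ eCount (Step.N :: r) := by
      rw [hP, nCount_append, nCount_E] at l1
      rw [hP, eCount_append, eCount_E] at l2
      omega
    obtain ⟨q, b, hqb, hq⟩ := exists_prime r hcount
    rw [hqb] at hP
    obtain ⟨s1, s2, s3, s4, s5, s6⟩ := swap_spec n hn lam hlam hlam' a q b hq hP
    refine ⟨a, q, b, hq, hP, ?_⟩
    apply ec_inj
    · rw [m1, s3]
    · intro k
      by_cases hk : k < n
      · rw [m3 k hk, s6 k hk, hmud, ha, hnd]
      · rw [ec_of_ge _ k (by omega), ec_of_ge _ k (by omega), m2, s4]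

end TamariMaxChains
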